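/- Let the pairs (U₁,V₁) and (U₂,V₂) of bounded linear operators on H satisfy the symplectic relations, set (U₃,V₃) := (U₂U₁ + V₂V̄₁, U₂V₁ + V₂Ū₁), let Z be a transposition-symmetric bounded operator with ‖Z‖ < 1, and put Z₁ := ζ(U₁,V₁; Z). Then (U₁* + Z V₁*)(U₂* + Z₁ V₂*) = U₃* + Z V₃*, and hence (U₂* + Z₁ V₂*)⁻¹ (U₁* + Z V₁*)⁻¹ = (U₃* + Z V₃*)⁻¹. -/

import Mathlib

open ContinuousLinearMap
open scoped InnerProductSpace

variable {H : Type*} [NormedAddCommGroup H] [InnerProductSpace ℂ H] [CompleteSpace H]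

/-- The complex conjugate `Ā := J ∘ A ∘ J` of a bounded operator with respect to the
conjugation `J`. -/
noncomputable def conjOp (J : H →L⋆[ℂ] H) (A : H →L[ℂ] H) : H →L[ℂ] H :=
  (J.comp A).comp J

/-- The transpose `Aᵀ := J ∘ A* ∘ J` of a bounded operator with respect to the
conjugation `J`. -/
noncomputable def transp (J : H →L⋆[ℂ] H) (A : H →L[ℂ] H) : H →L[ℂ] H :=
  conjOp J (adjoint A)

/-- The pair `(U, V)` satisfies the symplectic relations:
`U U* − V V* = 1`, `U Vᵀ = V Uᵀ`, `U* U − Vᵀ V̄ = 1`, `Uᵀ V̄ = V* U`. -/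
def SymplecticPair (J : H →L⋆[ℂ] H) (U V : H →L[ℂ] H) : Prop :=
  U ∘L adjoint U - V ∘L adjoint V = 1 ∧
  U ∘L transp J V = V ∘L transp J U ∧
  adjoint U ∘L U - transp J V ∘L conjOp J V = 1 ∧
  transp J U ∘L conjOp J V = adjoint V ∘L U

/-- The Siegel-disc action `ζ(U,V; Z) := (U* + Z V*)⁻¹ (Vᵀ + Z Uᵀ)`. -/
noncomputable def zeta (J : H →L⋆[ℂ] H) (U V Z : H →L[ℂ] H) : H →L[ℂ] H :=
  Ring.inverse (adjoint U + Z ∘L adjoint V) ∘L (transp J V + Z ∘L transp J U)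

/-- A norm-preserving conjugate-linear map reverses the inner product. -/
lemma inner_conj_map_map {E : Type*} [NormedAddCommGroup E] [InnerProductSpace ℂ E]
    (J : E →L⋆[ℂ] E) (hJnorm : ∀ x, ‖J x‖ = ‖x‖) (x y : E) :
    ⟪J x, J y⟫_ℂ = ⟪y, x⟫_ℂ := by
  have hadd : ‖J x + J y‖ = ‖x + y‖ := by rw [← map_add, hJnorm]
  have hsub : ‖J x - J y‖ = ‖x - y‖ := by rw [← map_sub, hJnorm]
  have haddI : ‖J x + Complex.I • J y‖ = ‖x - Complex.I • y‖ := by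
    rw [← hJnorm (x - Complex.I • y), map_sub, map_smulₛₗ]
    simp
  have hsubI : ‖J x - Complex.I • J y‖ = ‖x + Complex.I • y‖ := by
    rw [← hJnorm (x + Complex.I • y), map_add, map_smulₛₗ]
    simp [sub_eq_add_neg]
  rw [← inner_conj_symm y x, inner_eq_sum_norm_sq_div_four (𝕜 := ℂ) (J x) (J y),
    inner_eq_sum_norm_sq_div_four (𝕜 := ℂ) x y]
  simp only [RCLike.I_to_complex, hadd, hsub, haddI, hsubI]
  simp [Complex.conj_ofNat]
  ring

lemma adjoint_conjOp (J : H →L⋆[ℂ] H) (hJinv : ∀ x, J (J x) = x)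
    (hJnorm : ∀ x, ‖J x‖ = ‖x‖) (A : H →L[ℂ] H) :
    adjoint (conjOp J A) = transp J A := by
  refine (ContinuousLinearMap.eq_adjoint_iff _ _ |>.mpr fun x y => ?_).symm
  change ⟪J (adjoint A (J x)), y⟫_ℂ = ⟪x, J (A (J y))⟫_ℂ
  rw [← hJinv y, inner_conj_map_map J hJnorm, hJinv y, adjoint_inner_right,
    ← inner_conj_map_map J hJnorm, hJinv]

lemma isUnit_one_add_mul_star {R : Type*} [CStarAlgebra R] [PartialOrder R]
    [StarOrderedRing R] (a : R) : IsUnit (1 + a * star a) :=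
  CStarAlgebra.isUnit_of_le 1 (le_add_of_nonneg_right (mul_star_self_nonneg a))

/-- An element with an invertible left multiple and an invertible right multiple is invertible. -/
lemma isUnit_of_isUnit_mul_of_isUnit_mul {M : Type*} [Monoid M] {a b c : M}
    (hl : IsUnit (b * a)) (hr : IsUnit (a * c)) : IsUnit a := by
  obtain ⟨u, hu⟩ := hl
  obtain ⟨v, hv⟩ := hr
  refine isUnit_iff_exists_and_exists.mpr ⟨⟨c * ↑v⁻¹, ?_⟩, ⟨↑u⁻¹ * b, ?_⟩⟩
  · rw [← mul_assoc, ← hv, v.mul_inv]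
  · rw [mul_assoc, ← hu, u.inv_mul]

lemma Ring.inverse_mul_of_isUnit_left {M₀ : Type*} [MonoidWithZero M₀] {a : M₀}
    (ha : IsUnit a) (b : M₀) : Ring.inverse (a * b) = Ring.inverse b * Ring.inverse a := by
  obtain ⟨u, rfl⟩ := ha
  by_cases hb : IsUnit b
  · obtain ⟨v, rfl⟩ := hb
    rw [← Units.val_mul, Ring.inverse_unit, Ring.inverse_unit, Ring.inverse_unit,
      mul_inv_rev, Units.val_mul]
  · rw [Ring.inverse_non_unit b hb, zero_mul, Ring.inverse_non_unit]
    rwa [Units.isUnit_units_mul]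

namespace SymplecticPair

variable {J : H →L⋆[ℂ] H} {U V : H →L[ℂ] H}

lemma isUnit_adjoint (h : SymplecticPair J U V) (hJinv : ∀ x, J (J x) = x)
    (hJnorm : ∀ x, ‖J x‖ = ‖x‖) : IsUnit (adjoint U) := by
  obtain ⟨hUU, -, hU'U, -⟩ := h
  refine isUnit_of_isUnit_mul_of_isUnit_mul (b := U) (c := U) ?_ ?_
  · have hmul : U * adjoint U = 1 + V * star V := sub_eq_iff_eq_add.mp hUU
    exact hmul ▸ isUnit_one_add_mul_star V
  · have hmul : adjoint U * U = 1 + transp J V * star (transp J V) := by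
      rw [← adjoint_conjOp J hJinv hJnorm, star_eq_adjoint, adjoint_adjoint,
        adjoint_conjOp J hJinv hJnorm]
      exact sub_eq_iff_eq_add.mp hU'U
    exact hmul ▸ isUnit_one_add_mul_star _

lemma norm_adjoint_le (h : SymplecticPair J U V) (x : H) :
    ‖adjoint V x‖ ≤ ‖adjoint U x‖ := by
  have hx : U (adjoint U x) - V (adjoint V x) = x := DFunLike.congr_fun h.1 x
  have hre : ‖adjoint U x‖ ^ 2 - ‖adjoint V x‖ ^ 2 = ‖x‖ ^ 2 := by
    have := congrArg (fun y => RCLike.re ⟪y, x⟫_ℂ) hx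
    simpa only [inner_sub_left, map_sub, ← adjoint_inner_right U, ← adjoint_inner_right V,
      inner_self_eq_norm_sq] using this
  exact le_of_sq_le_sq (by nlinarith [sq_nonneg ‖x‖]) (norm_nonneg _)

lemma isUnit_adjoint_add (h : SymplecticPair J U V) (hJinv : ∀ x, J (J x) = x)
    (hJnorm : ∀ x, ‖J x‖ = ‖x‖) {Z : H →L[ℂ] H} (hZ : ‖Z‖ < 1) :
    IsUnit (adjoint U + Z ∘L adjoint V) := by
  obtain ⟨u, hu⟩ := h.isUnit_adjoint hJinv hJnorm
  have hle : ‖adjoint V * ↑u⁻¹‖ ≤ 1 := by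
    refine opNorm_le_bound _ zero_le_one fun x => ?_
    have hux : adjoint U ((↑u⁻¹ : H →L[ℂ] H) x) = x := by
      rw [← hu]
      exact DFunLike.congr_fun u.mul_inv x
    rw [one_mul]
    exact (h.norm_adjoint_le _).trans_eq (congrArg norm hux)
  have hlt : ‖-(Z * (adjoint V * ↑u⁻¹))‖ < 1 := by
    rw [norm_neg]
    exact (norm_mul_le _ _).trans_lt
      ((mul_le_of_le_one_right (norm_nonneg Z) hle).trans_lt hZ)
  have hfac : adjoint U + Z ∘L adjoint V = (1 - -(Z * (adjoint V * ↑u⁻¹))) * ↑u := by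
    rw [sub_neg_eq_add, add_mul, one_mul, mul_assoc, mul_assoc, u.inv_mul, mul_one, hu]
    rfl
  rw [hfac]
  exact (isUnit_one_sub_of_norm_lt_one hlt).mul u.isUnit

end SymplecticPair

/-- With `Z₁ := ζ(U₁,V₁; Z)` and `(U₃,V₃) = (U₂U₁ + V₂V̄₁, U₂V₁ + V₂Ū₁)`, one has
`(U₁* + Z V₁*)(U₂* + Z₁ V₂*) = U₃* + Z V₃*` and hence
`(U₂* + Z₁ V₂*)⁻¹ (U₁* + Z V₁*)⁻¹ = (U₃* + Z V₃*)⁻¹`. -/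
theorem statement14 (J : H →L⋆[ℂ] H) (hJinv : ∀ x, J (J x) = x) (hJnorm : ∀ x, ‖J x‖ = ‖x‖)
    (U₁ V₁ U₂ V₂ : H →L[ℂ] H)
    (h1 : SymplecticPair J U₁ V₁) (h2 : SymplecticPair J U₂ V₂)
    (Z : H →L[ℂ] H) (hZsym : Z = transp J Z) (hZ : ‖Z‖ < 1) :
    (adjoint U₁ + Z ∘L adjoint V₁) ∘L (adjoint U₂ + zeta J U₁ V₁ Z ∘L adjoint V₂)
      = adjoint (U₂ ∘L U₁ + V₂ ∘L conjOp J V₁) + Z ∘L adjoint (U₂ ∘L V₁ + V₂ ∘L conjOp J U₁) ∧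
    Ring.inverse (adjoint U₂ + zeta J U₁ V₁ Z ∘L adjoint V₂)
        ∘L Ring.inverse (adjoint U₁ + Z ∘L adjoint V₁)
      = Ring.inverse (adjoint (U₂ ∘L U₁ + V₂ ∘L conjOp J V₁)
          + Z ∘L adjoint (U₂ ∘L V₁ + V₂ ∘L conjOp J U₁)) := by
  have hA := h1.isUnit_adjoint_add hJinv hJnorm hZ
  have hprod : (adjoint U₁ + Z ∘L adjoint V₁) ∘L (adjoint U₂ + zeta J U₁ V₁ Z ∘L adjoint V₂)
      = adjoint (U₂ ∘L U₁ + V₂ ∘L conjOp J V₁)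
        + Z ∘L adjoint (U₂ ∘L V₁ + V₂ ∘L conjOp J U₁) := by
    have hzeta : (adjoint U₁ + Z ∘L adjoint V₁) ∘L zeta J U₁ V₁ Z
        = transp J V₁ + Z ∘L transp J U₁ := Ring.mul_inverse_cancel_left _ _ hA
    rw [comp_add, ← comp_assoc, hzeta]
    simp only [map_add, adjoint_comp, adjoint_conjOp J hJinv hJnorm, comp_add, add_comp,
      comp_assoc]
    abel
  refine ⟨hprod, ?_⟩
  rw [← hprod]
  exact (Ring.inverse_mul_of_isUnit_left hA _).symm
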